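/- Let Λ be a finite dimensional algebra over a field K with Jacobson radical J. If the injective dimensions of Λ as a left module and as a right module over itself are both finite, then l Fin dim Λ = r Fin dim Λ = l fin dim Λ = r fin dim Λ = idim(ΛΛ) = idim(ΛΛ) = pdim E(Λ(Λ/J)) = pdim E((Λ/J)Λ), where E(Λ(Λ/J)) and E((Λ/J)Λ) denote the injective envelopes of Λ/J as a left, respectively right, Λ-module. -/

import Mathlib

open CategoryTheory

universe u

section Preamble

variable (R : Type u) [Ring R]

/-- `PdimLE R n M` : the left `R`-module `M` has projective dimension at most `n`,
i.e. it admits a projective resolution of length at most `n`. -/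
def PdimLE : ℕ → ModuleCat.{u} R → Prop
  | 0, M => Module.Projective R M
  | n + 1, M =>
    ∃ (P : ModuleCat.{u} R) (f : ↥P →ₗ[R] ↥M),
      Module.Projective R ↥P ∧ Function.Surjective f ∧
        PdimLE n (ModuleCat.of R (LinearMap.ker f))

/-- `M` has projective dimension exactly `d`. -/
def PdimEq (M : ModuleCat.{u} R) (d : ℕ) : Prop :=
  PdimLE R d M ∧ ∀ k, PdimLE R k M → d ≤ k

/-- The projective dimension of `M`, as an element of `ℕ∞` (`⊤` = infinite). -/
noncomputable def pdim (M : ModuleCat.{u} R) : ℕ∞ :=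
  sInf {d : ℕ∞ | ∃ n : ℕ, d = n ∧ PdimLE R n M}

/-- `IdimLE R n M` : the left `R`-module `M` has injective dimension at most `n`. -/
def IdimLE : ℕ → ModuleCat.{u} R → Prop
  | 0, M => Module.Injective R M
  | n + 1, M =>
    ∃ (E : ModuleCat.{u} R) (f : ↥M →ₗ[R] ↥E),
      Module.Injective R ↥E ∧ Function.Injective f ∧
        IdimLE n (ModuleCat.of R (↥E ⧸ LinearMap.range f))

/-- The injective dimension of `M`, as an element of `ℕ∞`. -/
noncomputable def idim (M : ModuleCat.{u} R) : ℕ∞ :=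
  sInf {d : ℕ∞ | ∃ n : ℕ, d = n ∧ IdimLE R n M}

/-- The (left) big finitistic dimension of `R`: the supremum of the projective
dimensions of all (left) `R`-modules of finite projective dimension. -/
noncomputable def bigFinDim : ℕ∞ :=
  sSup {d : ℕ∞ | d ≠ ⊤ ∧ ∃ M : ModuleCat.{u} R, pdim R M = d}

/-- The (left) little finitistic dimension of `R`: the supremum of the projective
dimensions of all finitely generated (left) `R`-modules of finite projective dimension. -/
noncomputable def littleFinDim : ℕ∞ :=
  sSup {d : ℕ∞ | d ≠ ⊤ ∧ ∃ M : ModuleCat.{u} R, Module.Finite R ↥M ∧ pdim R M = d}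

/-- The (left) global dimension of `R`, as an element of `ℕ∞`. -/
noncomputable def glDim : ℕ∞ :=
  sInf {d : ℕ∞ | ∃ n : ℕ, d = n ∧ ∀ M : ModuleCat.{u} R, PdimLE R n M}

/-- `A` is (isomorphic to) a direct summand of `B`. -/
def IsSummand (A B : ModuleCat.{u} R) : Prop :=
  ∃ C : ModuleCat.{u} R, Nonempty ((↥A × ↥C) ≃ₗ[R] ↥B)

/-- A minimal projective resolution of `M`, recorded through its syzygies:
`Ω 0 ≅ M`, and for each `n` the map `f n : P n → Ω n` is a projective cover
(i.e. `P n` is projective, `f n` is surjective and its kernel is superfluous in `P n`),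
with `Ω (n+1) ≅ ker (f n)`. -/
structure SyzygyChain (M : ModuleCat.{u} R) : Type (u + 1) where
  Ω : ℕ → ModuleCat.{u} R
  P : ℕ → ModuleCat.{u} R
  projective : ∀ n, Module.Projective R ↥(P n)
  f : ∀ n, ↥(P n) →ₗ[R] ↥(Ω n)
  surj : ∀ n, Function.Surjective (f n)
  minimal : ∀ n, ∀ N : Submodule R ↥(P n), N ⊔ LinearMap.ker (f n) = ⊤ → N = ⊤
  iso0 : Nonempty (↥(Ω 0) ≃ₗ[R] ↥M)
  isoSucc : ∀ n, Nonempty (↥(Ω (n + 1)) ≃ₗ[R] ↥(LinearMap.ker (f n)))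

/-- The minimal projective resolution is repetitive at degree `k`: the `k`-th
syzygy decomposes as `P ⊕ ⨁ᵢ Aᵢ` with `P` projective and each `Aᵢ` a direct summand
of infinitely many syzygies. -/
def RepAt {M : ModuleCat.{u} R} (c : SyzygyChain R M) (k : ℕ) : Prop :=
  ∃ (ι : Type u) (A : ι → ModuleCat.{u} R) (P : ModuleCat.{u} R),
    Module.Projective R ↥P ∧
    (∀ i, {j : ℕ | IsSummand R (A i) (c.Ω j)}.Infinite) ∧
    Nonempty (↥(c.Ω k) ≃ₗ[R] (↥P × DirectSum ι fun i => ↥(A i)))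

/-- The repetition index of a module (with a given minimal projective resolution),
as an element of `ℕ∞`. -/
noncomputable def repIndex {M : ModuleCat.{u} R} (c : SyzygyChain R M) : ℕ∞ :=
  sInf {d : ℕ∞ | ∃ k : ℕ, d = k ∧ RepAt R c k}

/-- The (left) global repetition index of `R`. -/
noncomputable def glRep : ℕ∞ :=
  sSup {d : ℕ∞ | ∃ (M : ModuleCat.{u} R) (c : SyzygyChain R M), repIndex R c = d}

/-- The syzygy category of `M` (given a minimal projective resolution `c` of `M`)
is a Krull-Schmidt category of finite representation type, with the `s` modules
`A 0, …, A (s-1)` as representatives of the isomorphism classes of its nonzero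
indecomposable objects: the `A i` have local endomorphism rings, are pairwise
non-isomorphic, each occurs as a direct summand of some syzygy, and every syzygy
is a finite direct sum of copies of the `A i`. -/
def HasSyzygyType {M : ModuleCat.{u} R} (c : SyzygyChain R M) (s : ℕ)
    (A : Fin s → ModuleCat.{u} R) : Prop :=
  (∀ i, IsLocalRing (Module.End R ↥(A i))) ∧
  (∀ i j : Fin s, i ≠ j → IsEmpty (↥(A i) ≃ₗ[R] ↥(A j))) ∧
  (∀ i, ∃ j, IsSummand R (A i) (c.Ω j)) ∧
  (∀ j, ∃ m : Fin s → ℕ, Nonempty (↥(c.Ω j) ≃ₗ[R] ((i : Fin s) → Fin (m i) → ↥(A i))))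

/-- Truncating a minimal projective resolution of `M` gives a minimal projective
resolution of the `m`-th syzygy of `M`. -/
def SyzygyChain.shift {M : ModuleCat.{u} R} (c : SyzygyChain R M) (m : ℕ) :
    SyzygyChain R (c.Ω m) where
  Ω := fun j => c.Ω (m + j)
  P := fun j => c.P (m + j)
  projective := fun j => c.projective (m + j)
  f := fun j => c.f (m + j)
  surj := fun j => c.surj (m + j)
  minimal := fun j => c.minimal (m + j)
  iso0 := ⟨LinearEquiv.refl R ↥(c.Ω (m + 0))⟩
  isoSucc := fun j => c.isoSucc (m + j)

/-- The radical (Jacobson radical) of `R` as a left module over itself: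
the intersection of all maximal submodules. -/
def ringRadical : Submodule R R := sInf {m : Submodule R R | IsCoatom m}

/-- `R / rad R` as a left `R`-module. -/
noncomputable abbrev radQuot : ModuleCat.{u} R := ModuleCat.of R (R ⧸ ringRadical R)

/-- `X` embeds into `T`. -/
def EmbedsIn (X T : ModuleCat.{u} R) : Prop := ∃ g : ↥X →ₗ[R] ↥T, Function.Injective g

/-- The homological contingency of `A` to `M` (with minimal projective resolution `c`)
equals the integer `z`: `z` is the greatest element of `{-1} ∪ {j | A is a direct
summand of Ω^j(M)}`.  (So `z = -1` iff `A` is a summand of no syzygy, and no such `z`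
exists iff the contingency is infinite.) -/
def ContEq {M : ModuleCat.{u} R} (c : SyzygyChain R M) (A : ModuleCat.{u} R) (z : ℤ) : Prop :=
  IsGreatest (insert (-1) ((fun j : ℕ => (j : ℤ)) '' {j | IsSummand R A (c.Ω j)})) z

/-- `E` is an injective envelope of `X`: `E` is injective and contains a copy of `X`
as an essential submodule. -/
def IsInjectiveEnvelopeOf (X E : ModuleCat.{u} R) : Prop :=
  ∃ f : ↥X →ₗ[R] ↥E, Module.Injective R ↥E ∧ Function.Injective f ∧
    ∀ N : Submodule R ↥E, N ≠ ⊥ → N ⊓ LinearMap.range f ≠ ⊥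

end Preamble


section HomologicalDimension

variable {R : Type u} [Ring R]

theorem shortExact_of_exact {X Y Z : Type u} [AddCommGroup X] [Module R X]
    [AddCommGroup Y] [Module R Y] [AddCommGroup Z] [Module R Z]
    (f : X →ₗ[R] Y) (g : Y →ₗ[R] Z) (hfg : Function.Exact f g)
    (hf : Function.Injective f) (hg : Function.Surjective g) :
    (ModuleCat.shortComplexOfCompEqZero f g hfg.linearMap_comp_eq_zero).ShortExact :=
  ModuleCat.shortComplex_shortExact _ hfg hf hg

theorem hasProjectiveDimensionLE_succ_iff {X Y Z : Type u} [AddCommGroup X] [Module R X]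
    [AddCommGroup Y] [Module R Y] [AddCommGroup Z] [Module R Z] [Module.Projective R Y]
    (f : X →ₗ[R] Y) (g : Y →ₗ[R] Z) (hfg : Function.Exact f g)
    (hf : Function.Injective f) (hg : Function.Surjective g) (n : ℕ) :
    HasProjectiveDimensionLE (ModuleCat.of R Z) (n + 1) ↔
      HasProjectiveDimensionLE (ModuleCat.of R X) n :=
  (shortExact_of_exact f g hfg hf hg).hasProjectiveDimensionLT_X₃_iff n
    ((IsProjective.iff_projective Y).1 inferInstance)

theorem hasInjectiveDimensionLE_succ_iff {X Y Z : Type u} [AddCommGroup X] [Module R X]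
    [AddCommGroup Y] [Module R Y] [AddCommGroup Z] [Module R Z] [Module.Injective R Y]
    (f : X →ₗ[R] Y) (g : Y →ₗ[R] Z) (hfg : Function.Exact f g)
    (hf : Function.Injective f) (hg : Function.Surjective g) (n : ℕ) :
    HasInjectiveDimensionLE (ModuleCat.of R X) (n + 1) ↔
      HasInjectiveDimensionLE (ModuleCat.of R Z) n :=
  ((shortExact_of_exact f g hfg hf hg).hasInjectiveDimensionLT_X₃_iff n
    ((Module.injective_iff_injective_object R Y).1 inferInstance)).symm

theorem hasProjectiveDimensionLE_zero_iff (M : Type u) [AddCommGroup M] [Module R M] :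
    HasProjectiveDimensionLE (ModuleCat.of R M) 0 ↔ Module.Projective R M :=
  projective_iff_hasProjectiveDimensionLT_one.symm.trans (IsProjective.iff_projective M).symm

theorem hasInjectiveDimensionLE_zero_iff (M : Type u) [AddCommGroup M] [Module R M] :
    HasInjectiveDimensionLE (ModuleCat.of R M) 0 ↔ Module.Injective R M :=
  injective_iff_hasInjectiveDimensionLT_one.symm.trans
    (Module.injective_iff_injective_object R M).symm

theorem exists_free_surjection (M : Type u) [AddCommGroup M] [Module R M] :
    ∃ f : (M →₀ R) →ₗ[R] M, Function.Surjective f :=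
  ⟨Finsupp.linearCombination R id, Finsupp.linearCombination_id_surjective R M⟩

theorem exists_embedding_in_injective (M : ModuleCat.{u} R) :
    ∃ (E : ModuleCat.{u} R) (f : M →ₗ[R] E), Module.Injective R E ∧ Function.Injective f := by
  obtain ⟨I, hI, f, hf⟩ := EnoughInjectives.presentation M
  exact ⟨I, f.hom, (Module.injective_iff_injective_object R I).2 hI,
    (ModuleCat.mono_iff_injective f).1 hf⟩

theorem pdimLE_iff (n : ℕ) (M : ModuleCat.{u} R) :
    PdimLE R n M ↔ HasProjectiveDimensionLE M n := by
  induction n generalizing M with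
  | zero => exact (hasProjectiveDimensionLE_zero_iff M).symm
  | succ n ih =>
    constructor
    · rintro ⟨P, f, hP, hf, h⟩
      exact (hasProjectiveDimensionLE_succ_iff _ f f.exact_subtype_ker_map
        Subtype.val_injective hf n).2 ((ih _).1 h)
    · intro h
      obtain ⟨f, hf⟩ := exists_free_surjection (R := R) M
      exact ⟨ModuleCat.of R (M →₀ R), f, (inferInstance : Module.Projective R (M →₀ R)), hf,
        (ih _).2 ((hasProjectiveDimensionLE_succ_iff _ f f.exact_subtype_ker_map
          Subtype.val_injective hf n).1 h)⟩

theorem idimLE_iff (n : ℕ) (M : ModuleCat.{u} R) :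
    IdimLE R n M ↔ HasInjectiveDimensionLE M n := by
  induction n generalizing M with
  | zero => exact (hasInjectiveDimensionLE_zero_iff M).symm
  | succ n ih =>
    constructor
    · rintro ⟨E, f, hE, hf, h⟩
      exact (hasInjectiveDimensionLE_succ_iff f _ f.exact_map_mkQ_range hf
        (Submodule.mkQ_surjective _) n).2 ((ih _).1 h)
    · intro h
      obtain ⟨E, f, hE, hf⟩ := exists_embedding_in_injective M
      exact ⟨E, f, hE, hf, (ih _).2 ((hasInjectiveDimensionLE_succ_iff f _ f.exact_map_mkQ_range hf
        (Submodule.mkQ_surjective _) n).1 h)⟩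

theorem sInf_natCast_le_iff {p : ℕ → Prop} (hp : ∀ m n, m ≤ n → p m → p n) (n : ℕ) :
    sInf {d : ℕ∞ | ∃ n : ℕ, d = n ∧ p n} ≤ n ↔ p n := by
  refine ⟨fun h => ?_, fun h => sInf_le ⟨n, rfl, h⟩⟩
  have hne : {d : ℕ∞ | ∃ n : ℕ, d = n ∧ p n}.Nonempty := by
    by_contra hempty
    rw [Set.not_nonempty_iff_eq_empty.1 hempty, sInf_empty] at h
    simp at h
  obtain ⟨m, hm, hpm⟩ := csInf_mem hne
  rw [hm] at h
  exact hp m n (by exact_mod_cast h) hpm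

theorem pdim_le_iff (M : ModuleCat.{u} R) (n : ℕ) :
    pdim R M ≤ n ↔ HasProjectiveDimensionLE M n := by
  rw [pdim, sInf_natCast_le_iff, pdimLE_iff]
  intro m n hmn h
  rw [pdimLE_iff] at h ⊢
  exact hasProjectiveDimensionLT_of_ge M (m + 1) (n + 1) (by lia)

theorem idim_le_iff (M : ModuleCat.{u} R) (n : ℕ) :
    idim R M ≤ n ↔ HasInjectiveDimensionLE M n := by
  rw [idim, sInf_natCast_le_iff, idimLE_iff]
  intro m n hmn h
  rw [idimLE_iff] at h ⊢
  exact hasInjectiveDimensionLT_of_ge M (m + 1) (n + 1) (by lia)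

theorem hasProjectiveDimensionLE_of_retract {M N : Type u} [AddCommGroup M] [Module R M]
    [AddCommGroup N] [Module R N] (i : M →ₗ[R] N) (r : N →ₗ[R] M)
    (hri : r ∘ₗ i = LinearMap.id) {n : ℕ} (h : HasProjectiveDimensionLE (ModuleCat.of R N) n) :
    HasProjectiveDimensionLE (ModuleCat.of R M) n :=
  Retract.hasProjectiveDimensionLT (Y := ModuleCat.of R N)
    ⟨ModuleCat.ofHom i, ModuleCat.ofHom r, by rw [← ModuleCat.ofHom_comp, hri]; rfl⟩ (n + 1)

theorem hasInjectiveDimensionLE_of_retract {M N : Type u} [AddCommGroup M] [Module R M]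
    [AddCommGroup N] [Module R N] (i : M →ₗ[R] N) (r : N →ₗ[R] M)
    (hri : r ∘ₗ i = LinearMap.id) {n : ℕ} (h : HasInjectiveDimensionLE (ModuleCat.of R N) n) :
    HasInjectiveDimensionLE (ModuleCat.of R M) n :=
  Retract.hasInjectiveDimensionLT (Y := ModuleCat.of R N)
    ⟨ModuleCat.ofHom i, ModuleCat.ofHom r, by rw [← ModuleCat.ofHom_comp, hri]; rfl⟩ (n + 1)

theorem exists_retraction_of_injective {M N : Type u} [AddCommGroup M] [Module R M]
    [AddCommGroup N] [Module R N] [hM : Module.Injective R M] (i : M →ₗ[R] N)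
    (hi : Function.Injective i) : ∃ r : N →ₗ[R] M, r ∘ₗ i = LinearMap.id := by
  obtain ⟨r, hr⟩ := hM.out i hi LinearMap.id
  exact ⟨r, LinearMap.ext hr⟩

theorem exact_mapRange {X Y Z : Type u} [AddCommGroup X] [Module R X]
    [AddCommGroup Y] [Module R Y] [AddCommGroup Z] [Module R Z]
    (f : X →ₗ[R] Y) (g : Y →ₗ[R] Z) (hfg : Function.Exact f g)
    (hf : Function.Injective f) (ι : Type u) :
    Function.Exact (Finsupp.mapRange.linearMap (α := ι) f)
      (Finsupp.mapRange.linearMap (α := ι) g) := by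
  rw [LinearMap.exact_iff] at hfg ⊢
  rw [Finsupp.ker_mapRange, Finsupp.range_mapRange_linearMap f (LinearMap.ker_eq_bot.2 hf), hfg]

theorem injective_finsupp [IsNoetherianRing R] {E : Type u} [AddCommGroup E] [Module R E]
    [hE : Module.Injective R E] (ι : Type u) : Module.Injective R (ι →₀ E) := by
  classical
  refine Module.Baer.injective fun I g => ?_
  obtain ⟨S, hS⟩ : (⊤ : Submodule R I).FG := Module.Finite.fg_top
  let t : Finset ι := S.biUnion fun x => (g x).support
  have ht : ∀ x : I, g x ∈ Finsupp.supported E R (t : Set ι) := by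
    have : (⊤ : Submodule R I) ≤ (Finsupp.supported E R (t : Set ι)).comap g := by
      rw [← hS, Submodule.span_le]
      intro x hx
      exact (Finsupp.mem_supported R _).2
        (Finset.coe_subset.2 (Finset.subset_biUnion_of_mem (fun x => (g x).support) hx))
    exact fun x => this trivial
  have hbaer : Module.Baer R E := Module.Baer.of_injective hE
  choose h hh using fun i => hbaer I (Finsupp.lapply i ∘ₗ g)
  refine ⟨LinearMap.toSpanSingleton R _ (∑ i ∈ t, Finsupp.single i (h i 1)), fun x hx => ?_⟩
  ext i
  by_cases hi : i ∈ t
  · have hx1 : x • h i 1 = g ⟨x, hx⟩ i := by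
      rw [← map_smul, smul_eq_mul, mul_one]
      exact hh i x hx
    simpa [Finsupp.single_apply, hi] using hx1
  · have : g ⟨x, hx⟩ i = 0 := by
      have := (Finsupp.mem_supported' R _).1 (ht ⟨x, hx⟩) i
      exact this (by simpa using hi)
    simp [Finsupp.single_apply, hi, this]

theorem hasInjectiveDimensionLE_finsupp [IsNoetherianRing R] (ι : Type u) (n : ℕ)
    (M : ModuleCat.{u} R) (h : HasInjectiveDimensionLE M n) :
    HasInjectiveDimensionLE (ModuleCat.of R (ι →₀ M)) n := by
  induction n generalizing M with
  | zero =>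
    have := (hasInjectiveDimensionLE_zero_iff M).1 h
    exact (hasInjectiveDimensionLE_zero_iff _).2 (injective_finsupp ι)
  | succ n ih =>
    obtain ⟨E, f, hE, hf⟩ := exists_embedding_in_injective M
    have hexact := f.exact_map_mkQ_range
    have := injective_finsupp (R := R) (E := E) ι
    refine (hasInjectiveDimensionLE_succ_iff _ _ (exact_mapRange f _ hexact hf ι)
      (Finsupp.mapRange_injective _ (map_zero _) hf)
      (Finsupp.mapRange_surjective _ (map_zero _) (Submodule.mkQ_surjective _)) n).2
      (ih (ModuleCat.of R (E ⧸ LinearMap.range f)) ?_)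
    exact (hasInjectiveDimensionLE_succ_iff f _ hexact hf (Submodule.mkQ_surjective _) n).1 h

theorem hasProjectiveDimensionLE_finsupp (ι : Type u) (n : ℕ)
    (M : ModuleCat.{u} R) (h : HasProjectiveDimensionLE M n) :
    HasProjectiveDimensionLE (ModuleCat.of R (ι →₀ M)) n := by
  induction n generalizing M with
  | zero =>
    have := (hasProjectiveDimensionLE_zero_iff M).1 h
    classical
    exact (hasProjectiveDimensionLE_zero_iff _).2
      (Module.Projective.of_equiv (finsuppLequivDFinsupp (ι := ι) (M := M) R).symm)
  | succ n ih =>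
    obtain ⟨f, hf⟩ := exists_free_surjection (R := R) M
    have hexact := f.exact_subtype_ker_map
    refine (hasProjectiveDimensionLE_succ_iff _ _
      (exact_mapRange _ f hexact Subtype.val_injective ι)
      (Finsupp.mapRange_injective _ (map_zero _) Subtype.val_injective)
      (Finsupp.mapRange_surjective _ (map_zero _) hf) n).2
      (ih (ModuleCat.of R (LinearMap.ker f)) ?_)
    exact (hasProjectiveDimensionLE_succ_iff _ f hexact Subtype.val_injective hf n).1 h

/-- Over a noetherian ring of self-injective dimension at most `a`, finite projective dimensions
are bounded by `a`. -/
theorem hasProjectiveDimensionLE_of_selfInjective [IsNoetherianRing R] {a : ℕ}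
    (ha : HasInjectiveDimensionLE (ModuleCat.of R R) a) (M : ModuleCat.{u} R) (k : ℕ)
    (hM : HasProjectiveDimensionLE M (a + k)) : HasProjectiveDimensionLE M a := by
  induction k with
  | zero => exact hM
  | succ k ih =>
    refine ih (hasProjectiveDimensionLT_of_enoughInjectives M _ fun Y => ?_)
    obtain ⟨f, hf⟩ := exists_free_surjection (R := R) Y
    have hS := shortExact_of_exact (X := LinearMap.ker f) (LinearMap.ker f).subtype f
      f.exact_subtype_ker_map (Submodule.injective_subtype _) hf
    have hF := hasInjectiveDimensionLE_finsupp Y a _ ha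
    refine subsingleton_of_forall_eq 0 fun e => ?_
    obtain ⟨x, rfl⟩ := Abelian.Ext.covariant_sequence_exact₃ M hS e rfl
      (Abelian.Ext.eq_zero_of_hasProjectiveDimensionLT _ (a + (k + 1) + 1) (by lia))
    rw [Abelian.Ext.eq_zero_of_hasInjectiveDimensionLT x (a + 1) (by lia), Abelian.Ext.zero_comp]

end HomologicalDimension

section Cogenerator

variable {R : Type u} [Ring R]

/-- Over an artinian ring, a proper left ideal lies in the kernel of a map to `R / rad R` that does not
vanish at `1`. -/
theorem exists_linearMap_radQuot_ne_zero [IsArtinianRing R] (I : Submodule R R) (hI : I ≠ ⊤) :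
    ∃ g : R →ₗ[R] R ⧸ ringRadical R, I ≤ LinearMap.ker g ∧ g 1 ≠ 0 := by
  obtain ⟨m, hm, hIm⟩ := (eq_top_or_exists_le_coatom I).resolve_left hI
  have hJm : ringRadical R ≤ m := sInf_le hm
  have hss : IsSemisimpleModule R (R ⧸ ringRadical R) :=
    (IsArtinian.isSemisimpleModule_iff_jacobson R _).2 (Module.jacobson_quotient_jacobson R R)
  have hsurj : Function.Surjective (Submodule.factor hJm) := Submodule.factor_surjective hJm
  obtain ⟨s, hs⟩ := IsSemisimpleModule.lifting_property (Submodule.factor hJm) hsurj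
    (LinearMap.id : (R ⧸ m) →ₗ[R] R ⧸ m)
  refine ⟨s ∘ₗ m.mkQ, fun x hx => ?_, fun h => ?_⟩
  · have : m.mkQ x = 0 := (Submodule.Quotient.mk_eq_zero m).2 (hIm hx)
    simp [this]
  · have h1 : m.mkQ 1 = 0 := by
      have := LinearMap.congr_fun hs (m.mkQ 1)
      simp only [LinearMap.comp_apply, LinearMap.id_apply] at this h
      rw [← this, h, map_zero]
    have h1m : (1 : R) ∈ m := (Submodule.Quotient.mk_eq_zero m).1 h1
    exact hm.1 ((Ideal.eq_top_iff_one (I := m)).2 h1m)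

theorem exists_linearMap_ne_zero_of_radQuot_embeds [IsArtinianRing R] {E : Type u}
    [AddCommGroup E] [Module R E] [hE : Module.Injective R E]
    (f : R ⧸ ringRadical R →ₗ[R] E) (hf : Function.Injective f)
    {M : Type u} [AddCommGroup M] [Module R M] (x : M) (hx : x ≠ 0) :
    ∃ g : M →ₗ[R] E, g x ≠ 0 := by
  obtain ⟨g, hg, hg1⟩ := exists_linearMap_radQuot_ne_zero
    (LinearMap.ker (LinearMap.toSpanSingleton R M x)) (fun h => hx (by
      have : (1 : R) ∈ LinearMap.ker (LinearMap.toSpanSingleton R M x) := h ▸ trivial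
      simpa using this))
  obtain ⟨h, hh⟩ := hE.out ((LinearMap.ker (LinearMap.toSpanSingleton R M x)).liftQ
    (LinearMap.toSpanSingleton R M x) le_rfl) (by
      rw [← LinearMap.ker_eq_bot]; exact Submodule.ker_liftQ_eq_bot _ _ _ le_rfl)
    (f ∘ₗ (LinearMap.ker (LinearMap.toSpanSingleton R M x)).liftQ g hg)
  refine ⟨h, fun h0 => hg1 (hf ?_)⟩
  have := hh (Submodule.Quotient.mk 1)
  simp only [Submodule.liftQ_apply, LinearMap.toSpanSingleton_apply, one_smul, h0,
    LinearMap.comp_apply] at this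
  rw [← this, map_zero]

/-- An artinian module separated by its homomorphisms to `E` embeds in a finite power of `E`. -/
theorem exists_injective_finsupp_of_separating {E M : Type u} [AddCommGroup E] [Module R E]
    [AddCommGroup M] [Module R M] [IsArtinian R M]
    (h : ∀ x : M, x ≠ 0 → ∃ g : M →ₗ[R] E, g x ≠ 0) :
    ∃ (ι : Type u) (i : M →ₗ[R] ι →₀ E), Function.Injective i := by
  classical
  let k : Finset (M →ₗ[R] E) → Submodule R M := fun t => t.inf LinearMap.ker
  obtain ⟨t, ht⟩ := WellFounded.has_min (wellFounded_lt (α := Submodule R M)) (Set.range k)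
    ⟨_, ∅, rfl⟩
  obtain ⟨⟨t, rfl⟩, ht⟩ := ht
  refine ⟨t, (Finsupp.linearEquivFunOnFinite R E t).symm.toLinearMap ∘ₗ
    LinearMap.pi fun g => g.1, ?_⟩
  rw [← LinearMap.ker_eq_bot, LinearEquiv.ker_comp, LinearMap.ker_pi]
  rw [eq_bot_iff]
  intro x hx
  by_contra hx0
  obtain ⟨g, hg⟩ := h x hx0
  have hxt : x ∈ k t := by
    simp only [k, Submodule.mem_finsetInf]
    intro g hg
    exact (Submodule.mem_iInf _).1 hx ⟨g, hg⟩
  refine ht (k (insert g t)) ⟨_, rfl⟩ (lt_of_le_of_ne ?_ fun heq => hg ?_)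
  · exact Finset.inf_mono (Finset.subset_insert _ _)
  · rw [← heq] at hxt
    exact (Submodule.mem_finsetInf.1 hxt) g (Finset.mem_insert_self _ _)

end Cogenerator

section Duality

variable {K A B : Type u} [Field K] [Ring A] [Algebra K A] [Ring B] [Algebra K B]

/-- The `K`-dual of an `A`-module, as a `B`-module through `τ : B → Aᵐᵒᵖ`. -/
def OppDual (_τ : B →ₐ[K] Aᵐᵒᵖ) (M : Type u) [AddCommGroup M] [Module K M] : Type u :=
  Module.Dual K M

namespace OppDual

variable (τ : B →ₐ[K] Aᵐᵒᵖ) (M : Type u) [AddCommGroup M] [Module K M]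

instance : AddCommGroup (OppDual τ M) := inferInstanceAs (AddCommGroup (Module.Dual K M))

instance : Module K (OppDual τ M) := inferInstanceAs (Module K (Module.Dual K M))

instance [FiniteDimensional K M] : FiniteDimensional K (OppDual τ M) :=
  inferInstanceAs (FiniteDimensional K (Module.Dual K M))

/-- The identification of `OppDual τ M` with the `K`-dual of `M`. -/
def toDual : OppDual τ M ≃ₗ[K] Module.Dual K M := LinearEquiv.refl K _

variable {τ M}

theorem ext {φ ψ : OppDual τ M} (h : ∀ m, toDual τ M φ m = toDual τ M ψ m) : φ = ψ :=
  (toDual τ M).injective (LinearMap.ext h)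

variable [Module A M] [IsScalarTower K A M]

instance : SMul B (OppDual τ M) :=
  ⟨fun b φ => (toDual τ M).symm
    (toDual τ M φ ∘ₗ Algebra.lsmul K K M (MulOpposite.unop (τ b)))⟩

@[simp]
theorem toDual_smul (b : B) (φ : OppDual τ M) (m : M) :
    toDual τ M (b • φ) m = toDual τ M φ (MulOpposite.unop (τ b) • m) := rfl

instance : Module B (OppDual τ M) where
  one_smul φ := ext fun m => by simp
  mul_smul a b φ := ext fun m => by simp [mul_smul]
  smul_zero b := ext fun m => by simp
  smul_add b φ ψ := ext fun m => by simp
  add_smul a b φ := ext fun m => by simp [add_smul]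
  zero_smul φ := ext fun m => by simp

instance : IsScalarTower K B (OppDual τ M) where
  smul_assoc k b φ := ext fun m => by simp

/-- The dual of a linear map. -/
def map (τ : B →ₐ[K] Aᵐᵒᵖ) {N : Type u} [AddCommGroup N] [Module K N] [Module A N]
    [IsScalarTower K A N] (f : M →ₗ[A] N) : OppDual τ N →ₗ[B] OppDual τ M where
  toFun φ := (toDual τ M).symm (toDual τ N φ ∘ₗ f.restrictScalars K)
  map_add' φ ψ := ext fun m => by simp
  map_smul' b φ := ext fun m => by simp

@[simp]
theorem toDual_map {N : Type u} [AddCommGroup N] [Module K N] [Module A N]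
    [IsScalarTower K A N] (f : M →ₗ[A] N) (φ : OppDual τ N) (m : M) :
    toDual τ M (map τ f φ) m = toDual τ N φ (f m) := rfl

section Exactness

variable {N : Type u} [AddCommGroup N] [Module K N] [Module A N] [IsScalarTower K A N]

theorem map_surjective (f : M →ₗ[A] N) (hf : Function.Injective f) :
    Function.Surjective (map τ f) := by
  intro φ
  obtain ⟨ψ, hψ⟩ := (LinearMap.dualMap_surjective_of_injective (f := f.restrictScalars K) hf)
    (toDual τ M φ)
  exact ⟨(toDual τ N).symm ψ, ext fun m => LinearMap.congr_fun hψ m⟩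

theorem map_injective (f : M →ₗ[A] N) (hf : Function.Surjective f) :
    Function.Injective (map τ f) := by
  intro φ ψ h
  refine ext fun n => ?_
  obtain ⟨m, rfl⟩ := hf n
  rw [← toDual_map f φ, h, toDual_map]

theorem map_exact {L : Type u} [AddCommGroup L] [Module K L] [Module A L] [IsScalarTower K A L]
    (f : M →ₗ[A] N) (g : N →ₗ[A] L) (h : Function.Exact f g) (hg : Function.Surjective g) :
    Function.Exact (map τ g) (map τ f) := by
  intro φ
  constructor
  · intro hφ
    obtain ⟨s, hs⟩ := (g.restrictScalars K).exists_rightInverse_of_surjective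
      (LinearMap.range_eq_top.2 hg)
    refine ⟨(toDual τ L).symm (toDual τ N φ ∘ₗ s), ext fun n => ?_⟩
    obtain ⟨m, hm⟩ := (h (s (g n) - n)).1 (by
      rw [map_sub, sub_eq_zero]
      exact LinearMap.congr_fun hs (g n))
    have hφm := toDual_map f φ m
    rw [hφ, hm, map_sub] at hφm
    exact sub_eq_zero.1 hφm.symm
  · rintro ⟨ψ, rfl⟩
    refine ext fun m => ?_
    simp [h.apply_apply_eq_zero]

end Exactness

variable {σ : A →ₐ[K] Bᵐᵒᵖ}

/-- A homomorphism to a dual, with its two arguments exchanged. -/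
def flip (hστ : ∀ b, MulOpposite.unop (σ (MulOpposite.unop (τ b))) = b)
    {N : Type u} [AddCommGroup N] [Module K N] [Module B N] [IsScalarTower K B N]
    (g : M →ₗ[A] OppDual σ N) : N →ₗ[B] OppDual τ M where
  toFun n := (toDual τ M).symm
    (((toDual σ N).toLinearMap ∘ₗ g.restrictScalars K).flip n)
  map_add' x y := ext fun m => by simp
  map_smul' b x := ext fun m => by
    simp [hστ]

@[simp]
theorem toDual_flip (hστ : ∀ b, MulOpposite.unop (σ (MulOpposite.unop (τ b))) = b)
    {N : Type u} [AddCommGroup N] [Module K N] [Module B N] [IsScalarTower K B N]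
    (g : M →ₗ[A] OppDual σ N) (n : N) (m : M) :
    toDual τ M (flip hστ g n) m = toDual σ N (g m) n := rfl

/-- The canonical map to the double dual. -/
def eval (M : Type u) [AddCommGroup M] [Module K M] [Module A M] [IsScalarTower K A M]
    (hτσ : ∀ a, MulOpposite.unop (τ (MulOpposite.unop (σ a))) = a) :
    M →ₗ[A] OppDual σ (OppDual τ M) :=
  flip hτσ LinearMap.id

@[simp]
theorem toDual_eval (hτσ : ∀ a, MulOpposite.unop (τ (MulOpposite.unop (σ a))) = a)
    (m : M) (φ : OppDual τ M) : toDual σ _ (eval M hτσ m) φ = toDual τ M φ m := rfl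

theorem eval_bijective [FiniteDimensional K M]
    (hτσ : ∀ a, MulOpposite.unop (τ (MulOpposite.unop (σ a))) = a) :
    Function.Bijective (eval M hτσ) :=
  Module.bijective_dual_eval K M

theorem injective_of_projective (hτσ : ∀ a, MulOpposite.unop (τ (MulOpposite.unop (σ a))) = a)
    (hστ : ∀ b, MulOpposite.unop (σ (MulOpposite.unop (τ b))) = b)
    (N : Type u) [AddCommGroup N] [Module K N] [Module B N] [IsScalarTower K B N]
    [Module.Projective B N] : Module.Injective A (OppDual σ N) where
  out X Y _ _ _ _ f hf g := by
    let : Module K X := Module.compHom X (algebraMap K A)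
    let : Module K Y := Module.compHom Y (algebraMap K A)
    have : IsScalarTower K A X := ⟨fun k a x => by
      rw [Algebra.smul_def, mul_smul]; rfl⟩
    have : IsScalarTower K A Y := ⟨fun k a x => by
      rw [Algebra.smul_def, mul_smul]; rfl⟩
    obtain ⟨h, hh⟩ := Module.projective_lifting_property (map τ f) (flip (τ := τ) hστ g)
      (map_surjective f hf)
    refine ⟨flip hτσ h, fun x => ext fun n => ?_⟩
    rw [toDual_flip, ← toDual_map f (h n) x, ← toDual_flip hστ g, ← hh]
    rfl

theorem exists_injective_embedding
    (hτσ : ∀ a, MulOpposite.unop (τ (MulOpposite.unop (σ a))) = a)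
    (M : Type u) [AddCommGroup M] [Module K M] [Module A M] [IsScalarTower K A M]
    [FiniteDimensional K M] :
    ∃ (ι : Type u) (_ : Finite ι) (i : M →ₗ[A] OppDual σ (ι →₀ B)), Function.Injective i := by
  have : Module.Finite B (OppDual τ M) := Module.Finite.of_restrictScalars_finite K B _
  obtain ⟨S, hS⟩ : (⊤ : Submodule B (OppDual τ M)).FG := Module.Finite.fg_top
  let p : (S →₀ B) →ₗ[B] OppDual τ M := Finsupp.linearCombination B Subtype.val
  have hp : Function.Surjective p := by
    rw [← LinearMap.range_eq_top, Finsupp.range_linearCombination, Subtype.range_coe]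
    exact hS
  refine ⟨S, inferInstance, flip hτσ p, (injective_iff_map_eq_zero _).2 fun m hm => ?_⟩
  refine (Module.forall_dual_apply_eq_zero_iff K m).1 fun φ => ?_
  obtain ⟨x, hx⟩ := hp ((toDual τ M).symm φ)
  have hmx := toDual_flip hτσ p m x
  rw [hm, hx] at hmx
  exact hmx.symm

theorem projective_doubleDual (hστ : ∀ b, MulOpposite.unop (σ (MulOpposite.unop (τ b))) = b)
    (N : Type u) [AddCommGroup N] [Module K N] [Module B N] [IsScalarTower K B N]
    [FiniteDimensional K N] [Module.Projective B N] :
    Module.Projective B (OppDual τ (OppDual σ N)) :=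
  Module.Projective.of_equiv (LinearEquiv.ofBijective (eval N hστ) (eval_bijective hστ))

theorem injective_iff_projective (hτσ : ∀ a, MulOpposite.unop (τ (MulOpposite.unop (σ a))) = a)
    (hστ : ∀ b, MulOpposite.unop (σ (MulOpposite.unop (τ b))) = b)
    (M : Type u) [AddCommGroup M] [Module K M] [Module A M] [IsScalarTower K A M]
    [FiniteDimensional K M] [FiniteDimensional K B] :
    Module.Injective A M ↔ Module.Projective B (OppDual τ M) := by
  constructor
  · intro hM
    obtain ⟨ι, _, i, hi⟩ := exists_injective_embedding hτσ M
    obtain ⟨r, hr⟩ := exists_retraction_of_injective i hi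
    have := projective_doubleDual hστ (ι →₀ B)
    refine Module.Projective.of_split (map τ r) (map τ i) ?_
    refine LinearMap.ext fun φ => ext fun m => ?_
    exact congrArg (toDual τ M φ) (LinearMap.congr_fun hr m)
  · intro hN
    have := injective_of_projective (A := A) hτσ hστ (OppDual τ M)
    let e := LinearEquiv.ofBijective (eval M hτσ) (eval_bijective hτσ)
    exact (hasInjectiveDimensionLE_zero_iff M).1
      (hasInjectiveDimensionLE_of_retract e.toLinearMap e.symm.toLinearMap e.symm_comp
        ((hasInjectiveDimensionLE_zero_iff _).2 this))

theorem hasInjectiveDimensionLE_iff (hτσ : ∀ a, MulOpposite.unop (τ (MulOpposite.unop (σ a))) = a)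
    (hστ : ∀ b, MulOpposite.unop (σ (MulOpposite.unop (τ b))) = b)
    [FiniteDimensional K B] (n : ℕ)
    (M : Type u) [AddCommGroup M] [Module K M] [Module A M] [IsScalarTower K A M]
    [FiniteDimensional K M] :
    HasInjectiveDimensionLE (ModuleCat.of A M) n ↔
      HasProjectiveDimensionLE (ModuleCat.of B (OppDual τ M)) n := by
  induction n generalizing M with
  | zero =>
    rw [hasInjectiveDimensionLE_zero_iff, hasProjectiveDimensionLE_zero_iff]
    exact injective_iff_projective hτσ hστ M
  | succ n ih =>
    obtain ⟨ι, _, i, hi⟩ := exists_injective_embedding hτσ M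
    have := projective_doubleDual hστ (ι →₀ B)
    have := injective_of_projective (A := A) hτσ hστ (ι →₀ B)
    have hq := Submodule.mkQ_surjective (LinearMap.range i)
    rw [hasInjectiveDimensionLE_succ_iff i _ i.exact_map_mkQ_range hi hq,
      hasProjectiveDimensionLE_succ_iff _ _ (map_exact (τ := τ) i _ i.exact_map_mkQ_range hq)
        (map_injective _ hq) (map_surjective i hi)]
    exact ih _

end OppDual

theorem ENat.eq_of_forall_le_natCast_iff {a b : ℕ∞} (h : ∀ n : ℕ, a ≤ n ↔ b ≤ n) : a = b := by
  refine le_antisymm ?_ ?_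
  · induction b using ENat.recTopCoe with
    | top => exact le_top
    | coe b => exact (h b).2 le_rfl
  · induction a using ENat.recTopCoe with
    | top => exact le_top
    | coe a => exact (h a).1 le_rfl

variable {τ : B →ₐ[K] Aᵐᵒᵖ} {σ : A →ₐ[K] Bᵐᵒᵖ}

theorem pdim_oppDual_self (hτσ : ∀ a, MulOpposite.unop (τ (MulOpposite.unop (σ a))) = a)
    (hστ : ∀ b, MulOpposite.unop (σ (MulOpposite.unop (τ b))) = b)
    [FiniteDimensional K A] [FiniteDimensional K B] :
    pdim A (ModuleCat.of A (OppDual σ B)) = idim B (ModuleCat.of B B) :=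
  ENat.eq_of_forall_le_natCast_iff fun n => by
    rw [pdim_le_iff, idim_le_iff]
    exact (OppDual.hasInjectiveDimensionLE_iff hστ hτσ n B).symm

theorem idim_self_le_littleFinDim (hτσ : ∀ a, MulOpposite.unop (τ (MulOpposite.unop (σ a))) = a)
    (hστ : ∀ b, MulOpposite.unop (σ (MulOpposite.unop (τ b))) = b)
    [FiniteDimensional K A] [FiniteDimensional K B] (hB : idim B (ModuleCat.of B B) ≠ ⊤) :
    idim B (ModuleCat.of B B) ≤ littleFinDim A :=
  le_sSup ⟨hB, ModuleCat.of A (OppDual σ B), Module.Finite.of_restrictScalars_finite K A _,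
    pdim_oppDual_self hτσ hστ⟩

theorem pdim_injectiveEnvelope_radQuot (hτσ : ∀ a, MulOpposite.unop (τ (MulOpposite.unop (σ a))) = a)
    (hστ : ∀ b, MulOpposite.unop (σ (MulOpposite.unop (τ b))) = b)
    [FiniteDimensional K A] [FiniteDimensional K B] (hB : idim B (ModuleCat.of B B) ≠ ⊤)
    (E : ModuleCat.{u} A) (hE : IsInjectiveEnvelopeOf A (radQuot A) E) :
    pdim A E = idim B (ModuleCat.of B B) := by
  have : IsNoetherianRing B := IsNoetherianRing.of_finite K B
  have : IsArtinianRing A := IsArtinianRing.of_finite K A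
  obtain ⟨f, hEinj, hf, hess⟩ := hE
  obtain ⟨b, hb⟩ := ENat.ne_top_iff_exists.1 hB
  have hle : pdim A E ≤ b := by
    obtain ⟨ι, _, i, hi⟩ := OppDual.exists_injective_embedding (A := A) (σ := σ) hτσ
      (A ⧸ ringRadical A)
    have := OppDual.injective_of_projective (A := A) hτσ hστ (ι →₀ B)
    obtain ⟨g, hg⟩ := this.out f hf i
    have hginj : Function.Injective g := by
      rw [← LinearMap.ker_eq_bot]
      by_contra hne
      refine hess _ hne ((Submodule.eq_bot_iff _).2 ?_)
      rintro _ ⟨hy, x, rfl⟩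
      have hx : i x = 0 := (hg x).symm.trans hy
      rw [(map_eq_zero_iff i hi).1 hx, map_zero]
    obtain ⟨r, hr⟩ := exists_retraction_of_injective g hginj
    rw [pdim_le_iff]
    refine hasProjectiveDimensionLE_of_retract g r hr ?_
    rw [← OppDual.hasInjectiveDimensionLE_iff hστ hτσ]
    exact hasInjectiveDimensionLE_finsupp ι b _ ((idim_le_iff _ _).1 hb.ge)
  refine le_antisymm (hb ▸ hle) ?_
  obtain ⟨m, hm⟩ := ENat.ne_top_iff_exists.1 (ne_top_of_le_ne_top (ENat.natCast_ne_top b) hle)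
  rw [← pdim_oppDual_self hτσ hστ, ← hm, pdim_le_iff]
  have : IsArtinian A (OppDual σ B) := isArtinian_of_tower K inferInstance
  obtain ⟨ι, i, hi⟩ := exists_injective_finsupp_of_separating
    (exists_linearMap_ne_zero_of_radQuot_embeds (M := OppDual σ B) f hf)
  have := OppDual.injective_of_projective (A := A) hτσ hστ B
  obtain ⟨r, hr⟩ := exists_retraction_of_injective i hi
  exact hasProjectiveDimensionLE_of_retract i r hr
    (hasProjectiveDimensionLE_finsupp ι m E ((pdim_le_iff _ _).1 hm.ge))

end Duality

theorem littleFinDim_le_bigFinDim (R : Type u) [Ring R] : littleFinDim R ≤ bigFinDim R :=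
  sSup_le_sSup fun _ ⟨hd, M, _, hM⟩ => ⟨hd, M, hM⟩

theorem bigFinDim_le_idim_self (R : Type u) [Ring R] [IsNoetherianRing R] :
    bigFinDim R ≤ idim R (ModuleCat.of R R) := by
  refine sSup_le ?_
  rintro d ⟨hd, M, hM⟩
  obtain ⟨n, rfl⟩ := ENat.ne_top_iff_exists.1 hd
  generalize ha : idim R (ModuleCat.of R R) = a
  induction a using ENat.recTopCoe with
  | top => exact le_top
  | coe a =>
    rw [← hM, pdim_le_iff]
    refine hasProjectiveDimensionLE_of_selfInjective ((idim_le_iff _ _).1 ha.le) M n ?_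
    rw [← pdim_le_iff, hM]
    exact_mod_cast Nat.le_add_left n a

/-- For a finite dimensional algebra `Λ` over a field `K` whose
self-injective dimensions on both sides are finite, the big and little finitistic
dimensions on both sides, the self-injective dimensions on both sides, and the
projective dimensions of the injective envelopes of `Λ/J` on both sides all coincide. -/
theorem fd_algebra_dims_eq (K : Type u) [Field K] (Λ : Type u) [Ring Λ]
    [Algebra K Λ] [FiniteDimensional K Λ]
    (hl : idim Λ (ModuleCat.of Λ Λ) ≠ ⊤)
    (hr : idim Λᵐᵒᵖ (ModuleCat.of Λᵐᵒᵖ Λᵐᵒᵖ) ≠ ⊤) :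
    bigFinDim Λ = bigFinDim Λᵐᵒᵖ ∧
    bigFinDim Λ = littleFinDim Λ ∧
    bigFinDim Λ = littleFinDim Λᵐᵒᵖ ∧
    bigFinDim Λ = idim Λ (ModuleCat.of Λ Λ) ∧
    bigFinDim Λ = idim Λᵐᵒᵖ (ModuleCat.of Λᵐᵒᵖ Λᵐᵒᵖ) ∧
    (∀ E : ModuleCat.{u} Λ, IsInjectiveEnvelopeOf Λ (radQuot Λ) E →
      pdim Λ E = bigFinDim Λ) ∧
    (∀ E : ModuleCat.{u} Λᵐᵒᵖ, IsInjectiveEnvelopeOf Λᵐᵒᵖ (radQuot Λᵐᵒᵖ) E →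
      pdim Λᵐᵒᵖ E = bigFinDim Λ) := by
  have : IsNoetherianRing Λ := IsNoetherianRing.of_finite K Λ
  have : IsNoetherianRing Λᵐᵒᵖ := IsNoetherianRing.of_finite K Λᵐᵒᵖ
  let σ : Λ →ₐ[K] Λᵐᵒᵖᵐᵒᵖ := (AlgEquiv.opOp K Λ).toAlgHom
  let τ : Λᵐᵒᵖ →ₐ[K] Λᵐᵒᵖ := AlgHom.id K _
  have hτσ : ∀ a, MulOpposite.unop (τ (MulOpposite.unop (σ a))) = a := fun _ => rfl
  have hστ : ∀ b, MulOpposite.unop (σ (MulOpposite.unop (τ b))) = b := fun _ => rfl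
  have h₁ : idim Λ (ModuleCat.of Λ Λ) ≤ littleFinDim Λᵐᵒᵖ := idim_self_le_littleFinDim hστ hτσ hl
  have h₂ := littleFinDim_le_bigFinDim Λᵐᵒᵖ
  have h₃ := bigFinDim_le_idim_self Λᵐᵒᵖ
  have h₄ : idim Λᵐᵒᵖ (ModuleCat.of Λᵐᵒᵖ Λᵐᵒᵖ) ≤ littleFinDim Λ :=
    idim_self_le_littleFinDim hτσ hστ hr
  have h₅ := littleFinDim_le_bigFinDim Λ
  have h₆ := bigFinDim_le_idim_self Λ
  have hbl : bigFinDim Λ = idim Λ (ModuleCat.of Λ Λ) :=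
    le_antisymm h₆ (h₁.trans (h₂.trans (h₃.trans (h₄.trans h₅))))
  have hbr : bigFinDim Λ = idim Λᵐᵒᵖ (ModuleCat.of Λᵐᵒᵖ Λᵐᵒᵖ) :=
    le_antisymm (h₆.trans (h₁.trans (h₂.trans h₃))) (h₄.trans h₅)
  refine ⟨le_antisymm (h₆.trans (h₁.trans h₂)) (h₃.trans (h₄.trans h₅)),
    le_antisymm (h₆.trans (h₁.trans (h₂.trans (h₃.trans h₄)))) h₅,
    le_antisymm (h₆.trans h₁) (h₂.trans (h₃.trans (h₄.trans h₅))), hbl, hbr, fun E hE => ?_,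
    fun E hE => ?_⟩
  · rw [hbr]
    exact pdim_injectiveEnvelope_radQuot hτσ hστ hr E hE
  · rw [hbl]
    exact pdim_injectiveEnvelope_radQuot hστ hτσ hl E hE
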